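/- arXiv:2008.03714 — 2 statements merged into one kernel-verified Lean document; each statement's English description precedes it below -/
import Mathlib

section
/- If a substitution σ is a unifier of simple first-order terms t and u (that is, t[σ] = u[σ]), then σ satisfies every unifying equation of t and u: for every equation (x = s) ∈ U_{t,u}, one has σ(x) = s[σ]. -/
/-!
Simple first-order terms over a first-order signature `(F, ar)` (function
symbols `F` with arities `ar`): terms built from function symbols and
variables only, with no `λ` and no `fix`; finitely supported substitutions;
the generalisation order `M ≤ N ⟺ ∃σ, M[σ] = N`.
-/

/-- Simple first-order terms over the signature `(F, ar)`. -/
inductive STm (F : Type) (ar : F → ℕ) : Type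
  | var : ℕ → STm F ar
  | app : (f : F) → (Fin (ar f) → STm F ar) → STm F ar

namespace STm

variable {F : Type} {ar : F → ℕ}

/-- Apply a substitution (a map from variables to terms), homomorphically. -/
def subst (σ : ℕ → STm F ar) : STm F ar → STm F ar
  | var x => σ x
  | app f ts => app f fun i => subst σ (ts i)

/-- A substitution is finitely supported. -/
def FinSupp (σ : ℕ → STm F ar) : Prop := {x : ℕ | σ x ≠ var x}.Finite

/-- The generalisation order: `M ≤ N` iff some (finitely supported)
substitution `σ` satisfies `M[σ] = N`. -/
def Le (M N : STm F ar) : Prop := ∃ σ : ℕ → STm F ar, FinSupp σ ∧ subst σ M = N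

/-- `A` is a generalisation of `M` and `N` if `A ≤ M` and `A ≤ N`. -/
def IsGen (A M N : STm F ar) : Prop := Le A M ∧ Le A N

end STm

/-- The set of unifying equations of two simple first-order terms:
`e ∈ U_{t,u}` iff `UEq t u e`.  If `t` is a variable `x` then
`U_{t,u} = {x = u}`; else if `u` is a variable `x` then `U_{t,u} = {x = t}`;
else if `t = f(t₁,…,tₙ)` and `u = f(u₁,…,uₙ)` have the same head then
`U_{t,u} = ⋃ₖ U_{tₖ,uₖ}`; otherwise `U_{t,u} = ∅`. -/
inductive UEq {F : Type} {ar : F → ℕ} : STm F ar → STm F ar → ℕ × STm F ar → Prop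
  | varL (x : ℕ) (u : STm F ar) : UEq (.var x) u (x, u)
  | varR (f : F) (ts : Fin (ar f) → STm F ar) (x : ℕ) :
      UEq (.app f ts) (.var x) (x, .app f ts)
  | app {f : F} {ts us : Fin (ar f) → STm F ar} {e} (i : Fin (ar f)) :
      UEq (ts i) (us i) e → UEq (.app f ts) (.app f us) e

/-- A unifier of `t` and `u` satisfies each of their unifying equations. -/
theorem UEq.subst_eq {F : Type} {ar : F → ℕ} {σ : ℕ → STm F ar} {t u : STm F ar}
    {e : ℕ × STm F ar} (h : UEq t u e) (hunif : STm.subst σ t = STm.subst σ u) :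
    σ e.1 = STm.subst σ e.2 := by
  induction h with
  | varL x u => exact hunif
  | varR f ts x => exact hunif.symm
  | app i _ ih =>
    simp only [STm.subst, STm.app.injEq, heq_eq_eq, true_and] at hunif
    exact ih (congrFun hunif i)

/-- If `σ` is a unifier of the simple first-order terms `t` and `u`
(`t[σ] = u[σ]`), then `σ` satisfies every unifying equation of `t` and `u`:
for every `(x = s) ∈ U_{t,u}` one has `σ(x) = s[σ]`. -/
theorem unifier_satisfies_unifying_equations
    {F : Type} {ar : F → ℕ} (t u : STm F ar) (σ : ℕ → STm F ar)
    (hσ : STm.FinSupp σ) (hunif : STm.subst σ t = STm.subst σ u) :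
    ∀ (x : ℕ) (s : STm F ar), UEq t u (x, s) → σ x = STm.subst σ s := by
  exact fun _ _ h => h.subst_eq hunif
end

section
/- Let t and u be distinct simple first-order terms whose set of unifying equations U_{t,u} is empty. Then t and u are not unifiable: there is no substitution σ with t[σ] = u[σ]. -/
/-- Terms without unifying equations that become equal under some substitution are equal. -/
theorem STm.eq_of_subst_eq_of_no_unifying_equations {F : Type} {ar : F → ℕ}
    (σ : ℕ → STm F ar) (t u : STm F ar) (hU : ∀ e : ℕ × STm F ar, ¬ UEq t u e)
    (h : STm.subst σ t = STm.subst σ u) : t = u := by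
  induction t generalizing u with
  | var x => exact absurd (UEq.varL x u) (hU _)
  | app f ts ih =>
    cases u with
    | var x => exact absurd (UEq.varR f ts x) (hU _)
    | app g us =>
      simp only [STm.subst] at h
      obtain ⟨rfl, hs⟩ := STm.app.inj h
      congr 1
      funext i
      exact ih i (us i) (fun e he => hU e (UEq.app i he)) (congrFun (eq_of_heq hs) i)

/-- If `t` and `u` are distinct simple first-order terms whose set of unifying
equations `U_{t,u}` is empty, then `t` and `u` are not unifiable: no
substitution `σ` satisfies `t[σ] = u[σ]`. -/
theorem not_unifiable_of_no_unifying_equations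
    {F : Type} {ar : F → ℕ} (t u : STm F ar) (hne : t ≠ u)
    (hU : ∀ e : ℕ × STm F ar, ¬ UEq t u e) :
    ¬ ∃ σ : ℕ → STm F ar, STm.FinSupp σ ∧ STm.subst σ t = STm.subst σ u := by
  rintro ⟨σ, -, h⟩
  exact hne (STm.eq_of_subst_eq_of_no_unifying_equations σ t u hU h)
end
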